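/- arXiv:1404.1768 — 7 statements merged into one kernel-verified Lean document; each statement's English description precedes it below -/
import Mathlib

section
/- Let A, B be n×n complex matrices such that the pencil zB−A is regular, i.e. there exists z ∈ ℂ with det(zB−A) ≠ 0. Then there exist an integer d with 0 ≤ d ≤ n, invertible matrices S, T ∈ ℂ^{n×n}, an upper triangular matrix J ∈ ℂ^{d×d}, and a nilpotent matrix N ∈ ℂ^{(n−d)×(n−d)} such that, in 2×2 block form, T·A·S = [[J,0],[0,I_{n−d}]] and T·B·S = [[I_d,0],[0,N]]. -/
/-- Every endomorphism of a finite-dimensional vector space over an algebraically closed field is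
upper triangular in some basis. -/
theorem exists_basis_toMatrix_upperTriangular {K : Type*} [Field K] [IsAlgClosed K] (d : ℕ) :
    ∀ {V : Type*} [AddCommGroup V] [Module K V] [FiniteDimensional K V]
      (_ : Module.finrank K V = d) (f : Module.End K V),
      ∃ b : Module.Basis (Fin d) K V, ∀ i j, j < i → LinearMap.toMatrix b b f i j = 0 := by
  induction d with
  | zero =>
    intro V _ _ _ hV f
    exact ⟨Module.finBasisOfFinrankEq K V hV, fun i => i.elim0⟩
  | succ d ih =>
    intro V _ _ _ hV f
    have : Nontrivial V := Module.nontrivial_of_finrank_pos (R := K) (by omega)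
    obtain ⟨μ, hμ⟩ := Module.End.exists_eigenvalue f
    obtain ⟨v, hv⟩ := hμ.exists_hasEigenvector
    obtain ⟨W, hW⟩ := Submodule.exists_isCompl (K ∙ v)
    have hfr : Module.finrank K W = d := by
      have h1 := Submodule.finrank_add_eq_of_isCompl hW
      rw [finrank_span_singleton hv.2] at h1
      omega
    let π : V →ₗ[K] W := W.projectionOnto (K ∙ v) hW.symm
    have hπv : π v = 0 :=
      Submodule.projectionOnto_apply_of_mem_right hW.symm (Submodule.mem_span_singleton_self v)
    have hπW (w : W) : π w = w := Submodule.projectionOnto_apply_left hW.symm w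
    obtain ⟨c, hc⟩ := ih hfr (π ∘ₗ f ∘ₗ W.subtype)
    let b : Module.Basis (Fin (d + 1)) K V := Module.Basis.mkFinCons v c
      (fun a x hx h => by
        have h0 := congrArg π h
        rw [map_add, map_smul, hπv, smul_zero, zero_add, map_zero,
          show π x = ⟨x, hx⟩ from hπW ⟨x, hx⟩] at h0
        rw [show x = 0 from congrArg Subtype.val h0, add_zero] at h
        exact (smul_eq_zero.mp h).resolve_right hv.2)
      (fun z => by
        have hz : z ∈ (K ∙ v) ⊔ W := hW.sup_eq_top ▸ Submodule.mem_top
        obtain ⟨y, hy, w, hw, rfl⟩ := Submodule.mem_sup.mp hz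
        obtain ⟨a, rfl⟩ := Submodule.mem_span_singleton.mp hy
        exact ⟨-a, by simpa [add_right_comm] using hw⟩)
    have hb0 : b 0 = v := by simp [b]
    have hbs (k : Fin d) : b k.succ = c k := by simp [b]
    have hcoord (i : Fin d) : b.coord i.succ = c.coord i ∘ₗ π := by
      refine b.ext fun k => ?_
      refine Fin.cases ?_ (fun k => ?_) k
      · rw [LinearMap.comp_apply, Module.Basis.coord_apply, Module.Basis.repr_self, hb0, hπv]
        simp
      · rw [LinearMap.comp_apply, Module.Basis.coord_apply, Module.Basis.repr_self, hbs, hπW]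
        simp [Finsupp.single_apply]
    refine ⟨b, fun i j hij => ?_⟩
    rw [LinearMap.toMatrix_apply]
    obtain ⟨i, rfl⟩ := Fin.exists_succ_eq.mpr (Fin.ne_zero_of_lt hij)
    have hi := LinearMap.congr_fun (hcoord i) (f (b j))
    rw [Module.Basis.coord_apply] at hi
    rw [hi]
    induction j using Fin.cases with
    | zero => rw [hb0, hv.apply_eq_smul]; simp [hπv]
    | succ j =>
      rw [hbs]
      simpa [LinearMap.toMatrix_apply] using hc i j (Fin.succ_lt_succ_iff.mp hij)

/-- Fitting decomposition: an endomorphism is the direct sum of an automorphism and a nilpotent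
endomorphism. -/
theorem exists_isCompl_isUnit_restrict_isNilpotent_restrict {K V : Type*} [Field K]
    [AddCommGroup V] [Module K V] [FiniteDimensional K V] (f : Module.End K V) :
    ∃ (p q : Submodule K V) (_ : IsCompl p q) (hp : ∀ x ∈ p, f x ∈ p) (hq : ∀ x ∈ q, f x ∈ q),
      IsUnit (M := Module.End K p) (f.restrict hp) ∧
      IsNilpotent (R := Module.End K q) (f.restrict hq) := by
  obtain ⟨k, hk, hk1⟩ := (f.eventually_isCompl_ker_pow_range_pow.and
    (Filter.eventually_ge_atTop 1)).exists
  have hp : ∀ x ∈ LinearMap.range (f ^ k), f x ∈ LinearMap.range (f ^ k) := by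
    rintro _ ⟨y, rfl⟩
    exact ⟨f y, by rw [← Module.End.mul_apply, ← Module.End.mul_apply, ← pow_succ, ← pow_succ']⟩
  have hq : ∀ x ∈ LinearMap.ker (f ^ k), f x ∈ LinearMap.ker (f ^ k) := by
    intro x hx
    rw [LinearMap.mem_ker] at hx ⊢
    rw [← Module.End.mul_apply, ← pow_succ, pow_succ', Module.End.mul_apply, hx, map_zero]
  refine ⟨_, _, hk.symm, hp, hq, ?_, k, ?_⟩
  · rw [LinearMap.isUnit_iff_ker_eq_bot, LinearMap.ker_eq_bot']
    intro x hx
    have hfx : f x = 0 := congrArg Subtype.val hx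
    have hxk : (x : V) ∈ LinearMap.ker (f ^ k) := by
      have hpow := LinearMap.congr_fun (pow_sub_mul_pow f hk1) (x : V)
      rw [LinearMap.mem_ker, ← hpow, Module.End.mul_apply, pow_one, hfx, map_zero]
    exact Subtype.ext (Submodule.disjoint_def.mp hk.disjoint _ hxk x.2)
  · rw [Module.End.pow_restrict]
    ext x
    exact x.2

/-- A square matrix over an algebraically closed field is similar to a block diagonal matrix with
an invertible block, whose inverse is upper triangular, and a nilpotent block. -/
theorem Matrix.exists_similar_fromBlocks_isNilpotent {K : Type*} [Field K] [IsAlgClosed K] {n : ℕ}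
    (E : Matrix (Fin n) (Fin n) K) :
    ∃ (d e : ℕ) (h : d + e = n) (P Q : Matrix (Fin n) (Fin n) K)
      (L E₁ : Matrix (Fin d) (Fin d) K) (E₂ : Matrix (Fin e) (Fin e) K),
      Q * P = 1 ∧ L * E₁ = 1 ∧ (∀ i j, j < i → L i j = 0) ∧ IsNilpotent E₂ ∧
      Q * E * P = (Matrix.fromBlocks E₁ 0 0 E₂).submatrix
        ((finCongr h.symm).trans finSumFinEquiv.symm)
        ((finCongr h.symm).trans finSumFinEquiv.symm) := by
  obtain ⟨p, q, hpq, hp, hq, hu, hnil⟩ :=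
    exists_isCompl_isUnit_restrict_isNilpotent_restrict (Matrix.toLin' E)
  obtain ⟨u, hu⟩ := hu
  obtain ⟨b, hb⟩ := exists_basis_toMatrix_upperTriangular (Module.finrank K p) rfl
    (↑u⁻¹ : Module.End K p)
  let c := Module.finBasis K q
  have h : Module.finrank K p + Module.finrank K q = n := by
    simpa using Submodule.finrank_add_eq_of_isCompl hpq
  let φ := Submodule.prodEquivOfIsCompl p q hpq
  let σ := (finCongr h.symm).trans finSumFinEquiv.symm
  let a := (b.prod c).map φ
  let a' := a.reindex σ.symm
  let s := Pi.basisFun K (Fin n)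
  refine ⟨_, _, h, s.toMatrix a', a'.toMatrix s, LinearMap.toMatrix b b (↑u⁻¹ : Module.End K p),
    LinearMap.toMatrix b b (↑u : Module.End K p),
    LinearMap.toMatrix c c ((Matrix.toLin' E).restrict hq),
    a'.toMatrix_mul_toMatrix_flip s, ?_, hb, ?_, ?_⟩
  · rw [← LinearMap.toMatrix_mul, Units.inv_mul, LinearMap.toMatrix_one]
  · obtain ⟨k, hk⟩ := hnil
    exact ⟨k, by rw [LinearMap.toMatrix_pow, hk, map_zero]⟩
  · have hE : E = LinearMap.toMatrix s s (Matrix.toLin' E) := by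
      simp [s, LinearMap.toMatrix_eq_toMatrix']
    conv_lhs => rw [hE]
    rw [basis_toMatrix_mul_linearMap_toMatrix_mul_basis_toMatrix, ← LinearMap.toMatrix_prodMap, hu]
    ext i j
    simp only [Matrix.submatrix_apply, LinearMap.toMatrix_apply]
    have hφ (x : p × q) : Matrix.toLin' E (φ x) =
        φ ((((Matrix.toLin' E).restrict hp).prodMap ((Matrix.toLin' E).restrict hq)) x) := by
      simp [φ, LinearMap.restrict_apply, Matrix.mulVec_add]
    simp only [a', a, Module.Basis.repr_reindex, Module.Basis.reindex_apply,
      Module.Basis.map_apply, hφ, Module.Basis.map_repr, LinearEquiv.trans_apply,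
      LinearEquiv.symm_apply_apply, Equiv.symm_symm, Finsupp.mapDomain_equiv_apply]
    rfl


/-- **Weierstrass canonical form** (weakened: `J` only upper triangular).
If the pencil `z B - A` is regular, there exist `d + e = n`, invertible `S, T`,
an upper triangular `J` and a nilpotent `N` with
`T A S = [[J,0],[0,I]]` and `T B S = [[I,0],[0,N]]`. -/
theorem weierstrass_canonical_form (n : ℕ) (A B : Matrix (Fin n) (Fin n) ℂ)
    (hreg : ∃ z : ℂ, (z • B - A).det ≠ 0) :
    ∃ (d e : ℕ) (h : d + e = n)
      (S T : Matrix (Fin n) (Fin n) ℂ)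
      (J : Matrix (Fin d) (Fin d) ℂ) (N : Matrix (Fin e) (Fin e) ℂ),
      IsUnit S ∧ IsUnit T ∧
      (∀ i j : Fin d, j < i → J i j = 0) ∧
      IsNilpotent N ∧
      T * A * S =
        (Matrix.fromBlocks J 0 0 (1 : Matrix (Fin e) (Fin e) ℂ)).submatrix
          (fun i : Fin n => finSumFinEquiv.symm (Fin.cast h.symm i))
          (fun i : Fin n => finSumFinEquiv.symm (Fin.cast h.symm i)) ∧
      T * B * S =
        (Matrix.fromBlocks (1 : Matrix (Fin d) (Fin d) ℂ) 0 0 N).submatrix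
          (fun i : Fin n => finSumFinEquiv.symm (Fin.cast h.symm i))
          (fun i : Fin n => finSumFinEquiv.symm (Fin.cast h.symm i)) := by
  obtain ⟨z, hz⟩ := hreg
  let C := z • B - A
  have hC : IsUnit C.det := hz.isUnit
  obtain ⟨d, e, h, P, Q, L, E₁, E₂, hQP, hLE, hL, hnil, hE⟩ :=
    Matrix.exists_similar_fromBlocks_isNilpotent (C⁻¹ * B)
  have hA : C⁻¹ * A = z • (C⁻¹ * B) - 1 := by
    rw [← Matrix.nonsing_inv_mul C hC, ← Matrix.mul_smul, ← Matrix.mul_sub]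
    simp [C]
  obtain ⟨U, hU⟩ : IsUnit (z • E₂ - 1) := (hnil.smul z).isUnit_sub_one
  have hcomm : Commute (↑U⁻¹ : Matrix (Fin e) (Fin e) ℂ) E₂ := by
    refine Commute.units_inv_left ?_
    rw [hU]
    exact ((Commute.refl E₂).smul_left z).sub_left (Commute.one_left E₂)
  let σ := (finCongr h.symm).trans finSumFinEquiv.symm
  let R : Matrix (Fin d ⊕ Fin e) (Fin d ⊕ Fin e) ℂ := Matrix.fromBlocks L 0 0 ↑U⁻¹
  have hR : IsUnit R :=
    Matrix.isUnit_fromBlocks_zero₂₁.mpr ⟨IsUnit.of_mul_eq_one _ hLE, Units.isUnit _⟩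
  refine ⟨d, e, h, P, R.submatrix σ σ * Q * C⁻¹, z • 1 - L, (↑U⁻¹ : Matrix (Fin e) (Fin e) ℂ) * E₂,
    IsUnit.of_mul_eq_one_right _ hQP, ?_, ?_, hcomm.isNilpotent_mul_left hnil, ?_, ?_⟩
  · exact (((Matrix.isUnit_submatrix_equiv _ _).mpr hR).mul
      (IsUnit.of_mul_eq_one _ hQP)).mul ((Matrix.isUnit_nonsing_inv_iff).mpr
        ((Matrix.isUnit_iff_isUnit_det _).mpr hC))
  · intro i j hij
    simp [hL i j hij, Matrix.one_apply_ne hij.ne']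
  · calc R.submatrix σ σ * Q * C⁻¹ * A * P
        = R.submatrix σ σ * (z • (Q * (C⁻¹ * B) * P) - Q * P) := by
          rw [Matrix.mul_assoc _ C⁻¹ A, hA]
          simp only [Matrix.mul_assoc, Matrix.mul_sub, Matrix.sub_mul, Matrix.mul_smul,
            Matrix.smul_mul, Matrix.one_mul]
      _ = (R * (z • Matrix.fromBlocks E₁ 0 0 E₂ - 1)).submatrix σ σ := by
          rw [hE, hQP, ← Matrix.submatrix_mul_equiv _ _ σ σ σ, ← Matrix.submatrix_one_equiv σ]
          rfl
      _ = (Matrix.fromBlocks (z • 1 - L) 0 0 1).submatrix σ σ := by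
          congr 1
          rw [← Matrix.fromBlocks_one, Matrix.fromBlocks_smul, sub_eq_add_neg,
            Matrix.fromBlocks_neg, Matrix.fromBlocks_add, Matrix.fromBlocks_multiply]
          simp [← sub_eq_add_neg, ← hU, Matrix.mul_sub, hLE]
  · calc R.submatrix σ σ * Q * C⁻¹ * B * P
        = R.submatrix σ σ * (Q * (C⁻¹ * B) * P) := by simp only [Matrix.mul_assoc]
      _ = (R * Matrix.fromBlocks E₁ 0 0 E₂).submatrix σ σ := by
          rw [hE, ← Matrix.submatrix_mul_equiv _ _ σ σ σ]
      _ = (Matrix.fromBlocks 1 0 0 ((↑U⁻¹ : Matrix (Fin e) (Fin e) ℂ) * E₂)).submatrix σ σ := by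
          simp [R, Matrix.fromBlocks_multiply, hLE]
end

section
/- Suppose the pencil zB−A is in Weierstrass form with data (S,T,d,J,N) and that J splits at s, i.e. J = [[J₁,0],[0,J₂]] with J₁ ∈ ℂ^{s×s}. Let D, L ∈ ℂ^{n×t} be arbitrary, set F₀ := S₁·T₁ (an n×n matrix), R := F₀·D, Â := L*·A·R and B̂ := L*·B·R. Then for every z ∈ ℂ one has the t×t matrix identity z·B̂ − Â = (L*·(T^{-1})_{(:,1:s)})·(z·I_s − J₁)·(T₁·D), where (T^{-1})_{(:,1:s)} is the n×s matrix of the first s columns of T^{-1}. -/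
open Matrix

/-- If `T * X * S` is block diagonal with leading block `X₁`, then `X` maps the leading columns
of `S` to the leading columns of `T⁻¹` multiplied by `X₁`. -/
theorem mul_submatrix_eq_inv_submatrix_mul {a b c K : Type*} [Fintype a] [Fintype b] [Fintype c]
    [DecidableEq a] [DecidableEq b] [DecidableEq c] [CommRing K]
    {X S T : Matrix ((a ⊕ b) ⊕ c) ((a ⊕ b) ⊕ c) K}
    {X₁ : Matrix a a K} {X₂ : Matrix b b K} {Y : Matrix c c K} (hT : IsUnit T)
    (h : T * X * S = Matrix.fromBlocks (Matrix.fromBlocks X₁ 0 0 X₂) 0 0 Y) :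
    X * S.submatrix id (fun j : a => Sum.inl (Sum.inl j)) =
      (T⁻¹).submatrix id (fun j : a => Sum.inl (Sum.inl j)) * X₁ := by
  have hXS : X * S = T⁻¹ * Matrix.fromBlocks (Matrix.fromBlocks X₁ 0 0 X₂) 0 0 Y := by
    rw [← h, Matrix.mul_assoc T, Matrix.nonsing_inv_mul_cancel_left _ _
      ((Matrix.isUnit_iff_isUnit_det T).1 hT)]
  ext i j
  have hij := congrFun (congrFun hXS i) (Sum.inl (Sum.inl j))
  simpa [Matrix.mul_apply, Fintype.sum_sum_type] using hij

/-- Matrix-identity form of Theorem 2.2 (CIRR projected pencil):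
`z B̂ - Â = (Lᴴ (T⁻¹)₁) (z I_s - J₁) (T₁ D)`.
The dimensions are `n = (s + r) + e` with `d = s + r`, encoded by the index type
`(Fin s ⊕ Fin r) ⊕ Fin e`; "first `s` columns/rows" are those indexed by
`Sum.inl ∘ Sum.inl`. -/
theorem cirr_projected_pencil (s r e t : ℕ)
    (A B S T : Matrix ((Fin s ⊕ Fin r) ⊕ Fin e) ((Fin s ⊕ Fin r) ⊕ Fin e) ℂ)
    (J : Matrix (Fin s ⊕ Fin r) (Fin s ⊕ Fin r) ℂ)
    (J₁ : Matrix (Fin s) (Fin s) ℂ) (J₂ : Matrix (Fin r) (Fin r) ℂ)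
    (N : Matrix (Fin e) (Fin e) ℂ)
    (hS : IsUnit S) (hT : IsUnit T) (hN : IsNilpotent N)
    (hA : T * A * S = Matrix.fromBlocks J 0 0 (1 : Matrix (Fin e) (Fin e) ℂ))
    (hB : T * B * S = Matrix.fromBlocks (1 : Matrix (Fin s ⊕ Fin r) (Fin s ⊕ Fin r) ℂ) 0 0 N)
    (hJ : J = Matrix.fromBlocks J₁ 0 0 J₂)
    (D L : Matrix ((Fin s ⊕ Fin r) ⊕ Fin e) (Fin t) ℂ)
    (S₁ : Matrix ((Fin s ⊕ Fin r) ⊕ Fin e) (Fin s) ℂ)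
    (hS₁ : S₁ = S.submatrix id (fun j : Fin s => Sum.inl (Sum.inl j)))
    (T₁ : Matrix (Fin s) ((Fin s ⊕ Fin r) ⊕ Fin e) ℂ)
    (hT₁ : T₁ = T.submatrix (fun i : Fin s => Sum.inl (Sum.inl i)) id)
    (F₀ : Matrix ((Fin s ⊕ Fin r) ⊕ Fin e) ((Fin s ⊕ Fin r) ⊕ Fin e) ℂ)
    (hF₀ : F₀ = S₁ * T₁)
    (R Ahat Bhat : _)
    (hR : R = F₀ * D)
    (hAhat : Ahat = Lᴴ * A * R) (hBhat : Bhat = Lᴴ * B * R) :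
    ∀ z : ℂ,
      z • Bhat - Ahat =
        (Lᴴ * (T⁻¹).submatrix id (fun j : Fin s => Sum.inl (Sum.inl j))) *
          (z • (1 : Matrix (Fin s) (Fin s) ℂ) - J₁) * (T₁ * D) := by
  intro z
  subst hJ
  have hAS := mul_submatrix_eq_inv_submatrix_mul hT hA
  rw [← Matrix.fromBlocks_one] at hB
  have hBS := mul_submatrix_eq_inv_submatrix_mul hT hB
  rw [← hS₁] at hAS hBS
  have hA' : Ahat = Lᴴ * (A * S₁) * (T₁ * D) := by
    rw [hAhat, hR, hF₀]
    simp only [Matrix.mul_assoc]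
  have hB' : Bhat = Lᴴ * (B * S₁) * (T₁ * D) := by
    rw [hBhat, hR, hF₀]
    simp only [Matrix.mul_assoc]
  rw [hA', hB', hAS, hBS]
  simp only [Matrix.mul_one, Matrix.mul_sub, Matrix.sub_mul, Matrix.mul_smul, Matrix.smul_mul,
    Matrix.mul_assoc]
end

section
/- Let M be an s×n complex matrix of rank s (s ≤ n). Then the set of real n×s matrices Y such that the complex s×s matrix M·Y is singular (where Y is regarded as a complex matrix via the inclusion ℝ ⊆ ℂ), i.e. {Y ∈ ℝ^{n×s} : det(M·Y) = 0}, has Lebesgue measure zero in the space of real n×s matrices (identified with ℝ^{ns} with its Lebesgue measure). Consequently, if the entries of Y are i.i.d. random variables with a distribution absolutely continuous with respect to Lebesgue measure, then M·Y is nonsingular with probability 1. -/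
open MeasureTheory

/-- Currying identifies a product measure over `ι × κ` with the iterated product measure. -/
theorem measurePreserving_curry_symm_pi {ι κ X : Type*} [Fintype ι] [Fintype κ]
    [MeasurableSpace X] (μ : Measure X) [SigmaFinite μ] :
    MeasurePreserving (MeasurableEquiv.curry ι κ X).symm
      (Measure.pi fun _ : ι => Measure.pi fun _ : κ => μ)
      (Measure.pi fun _ : ι × κ => μ) := by
  refine ⟨(MeasurableEquiv.curry ι κ X).symm.measurable, (Measure.pi_eq fun t ht => ?_).symm⟩
  have hpre : (MeasurableEquiv.curry ι κ X).symm ⁻¹' Set.univ.pi t =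
      Set.univ.pi fun i => Set.univ.pi fun j => t (i, j) := by
    ext x
    simp only [Set.mem_preimage, Set.mem_pi, Set.mem_univ, true_implies, Prod.forall]
    rfl
  rw [MeasurableEquiv.map_apply, hpre, Measure.pi_pi, Fintype.prod_prod_type]
  simp_rw [Measure.pi_pi]

/-- The real zero set of a nonzero complex polynomial in one variable is null for every measure
without atoms. -/
theorem Polynomial.measure_setOf_eval_ofReal_eq_zero (μ : Measure ℝ) [NullSingletonClass μ]
    {q : Polynomial ℂ} (hq : q ≠ 0) : μ {x : ℝ | q.eval (x : ℂ) = 0} = 0 := by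
  refine Set.Finite.measure_zero ?_ μ
  refine Set.Finite.subset
    (q.roots.toFinset.finite_toSet.preimage Complex.ofReal_injective.injOn) fun x hx => ?_
  simpa [hq] using hx

theorem MvPolynomial.isClosed_setOf_eval_ofReal_eq_zero {σ : Type*} (p : MvPolynomial σ ℂ) :
    IsClosed {x : σ → ℝ | MvPolynomial.eval (fun i => (x i : ℂ)) p = 0} :=
  isClosed_eq (p.continuous_eval.comp (by fun_prop)) continuous_const

theorem MvPolynomial.measure_pi_fin_setOf_eval_ofReal_eq_zero (μ : Measure ℝ) [SigmaFinite μ]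
    [NullSingletonClass μ] {m : ℕ} {p : MvPolynomial (Fin m) ℂ} (hp : p ≠ 0) :
    (Measure.pi fun _ : Fin m => μ)
      {x | MvPolynomial.eval (fun i => (x i : ℂ)) p = 0} = 0 := by
  induction m with
  | zero =>
    obtain ⟨c, rfl⟩ := MvPolynomial.C_surjective (Fin 0) p
    have hc : c ≠ 0 := by simpa using hp
    simp [hc]
  | succ m ih =>
    have hq : MvPolynomial.finSuccEquiv ℂ m p ≠ 0 := by simpa using hp
    obtain ⟨k, hk⟩ : ∃ k, (MvPolynomial.finSuccEquiv ℂ m p).coeff k ≠ 0 := by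
      by_contra! h
      exact hq (Polynomial.ext (by simpa using h))
    have hZ := p.isClosed_setOf_eval_ofReal_eq_zero.measurableSet
    have e := (measurePreserving_piFinSuccAbove (fun _ : Fin (m + 1) => μ) 0).symm
    rw [← e.measure_preimage_equiv, Measure.prod_apply_symm (e.measurable hZ),
      lintegral_eq_zero_iff (measurable_measure_prodMk_right (e.measurable hZ))]
    have hae : ∀ᵐ y ∂(Measure.pi fun _ : Fin m => μ),
        MvPolynomial.eval (fun i => (y i : ℂ)) ((MvPolynomial.finSuccEquiv ℂ m p).coeff k) ≠ 0 := by
      simpa [ae_iff] using ih hk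
    filter_upwards [hae] with y hy
    have hqy : (MvPolynomial.finSuccEquiv ℂ m p).map
        (MvPolynomial.eval fun i => (y i : ℂ)) ≠ 0 := fun h =>
      hy (by simpa using congrArg (Polynomial.coeff · k) h)
    refine Eq.trans (congrArg μ (Set.ext fun t => ?_))
      (Polynomial.measure_setOf_eval_ofReal_eq_zero μ hqy)
    rw [Set.mem_ofPred_eq, ← MvPolynomial.eval_eq_eval_mv_eval']
    have hcons : (fun i => (((MeasurableEquiv.piFinSuccAbove (fun _ : Fin (m + 1) => ℝ) 0).symm
        (t, y) i : ℝ) : ℂ)) = (Fin.cons (t : ℂ) fun i => (y i : ℂ) : Fin (m + 1) → ℂ) := by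
      ext i
      refine Fin.cases ?_ (fun j => ?_) i <;> simp [MeasurableEquiv.piFinSuccAbove]
    rw [← hcons]
    rfl

/-- The real zero set of a nonzero complex polynomial in finitely many variables is null for every
power of a measure without atoms. -/
theorem MvPolynomial.measure_pi_setOf_eval_ofReal_eq_zero {σ : Type*} [Fintype σ]
    (μ : Measure ℝ) [SigmaFinite μ] [NullSingletonClass μ] {p : MvPolynomial σ ℂ} (hp : p ≠ 0) :
    (Measure.pi fun _ : σ => μ)
      {x | MvPolynomial.eval (fun i => (x i : ℂ)) p = 0} = 0 := by
  let f := Fintype.equivFin σ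
  have e := measurePreserving_piCongrLeft (fun _ : σ => μ) f.symm
  have hr : MvPolynomial.rename f p ≠ 0 := by
    simpa using (MvPolynomial.rename_injective f f.injective).ne hp
  rw [← e.measure_preimage_equiv,
    ← MvPolynomial.measure_pi_fin_setOf_eval_ofReal_eq_zero μ hr]
  congr 1
  ext x
  have hx : (fun i => ((MeasurableEquiv.piCongrLeft (fun _ : σ => ℝ) f.symm x i : ℝ) : ℂ)) =
      (fun j => (x j : ℂ)) ∘ f := by
    ext i
    rw [← f.symm_apply_apply i, MeasurableEquiv.coe_piCongrLeft,
      Equiv.piCongrLeft_apply_apply]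
    simp
  simp only [Set.mem_preimage, Set.mem_ofPred_eq, MvPolynomial.eval_rename, hx]

theorem Matrix.exists_mul_eq_one_of_rank_eq_card {m n K : Type*} [Fintype m] [DecidableEq m]
    [Fintype n] [Field K] (M : Matrix m n K) (hM : M.rank = Fintype.card m) :
    ∃ B : Matrix n m K, M * B = 1 := by
  classical
  rw [← Matrix.mulVec_surjective_iff_exists_right_inverse]
  have h : LinearMap.range M.mulVecLin = ⊤ :=
    Submodule.eq_top_of_finrank_eq (by simpa [Matrix.rank] using hM)
  exact LinearMap.range_eq_top.mp h

/-- The determinant of `M * X` as a polynomial in the entries of the generic matrix `X`. -/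
noncomputable def Matrix.detMulGeneric {m n R : Type*} [Fintype m] [DecidableEq m] [Fintype n]
    [CommRing R] (M : Matrix m n R) : MvPolynomial (n × m) R :=
  (Matrix.of fun i j => ∑ k, MvPolynomial.C (M i k) * MvPolynomial.X (k, j)).det

theorem Matrix.eval_detMulGeneric {m n R : Type*} [Fintype m] [DecidableEq m] [Fintype n]
    [CommRing R] (M : Matrix m n R) (x : n × m → R) :
    MvPolynomial.eval x M.detMulGeneric = (M * Matrix.of fun i j => x (i, j)).det := by
  rw [Matrix.detMulGeneric, RingHom.map_det, RingHom.mapMatrix_apply]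
  congr 1
  ext i j
  simp [Matrix.mul_apply]

theorem Matrix.measure_pi_setOf_det_mul_ofReal_eq_zero {m n : Type*} [Fintype m] [DecidableEq m]
    [Fintype n] (M : Matrix m n ℂ) (hM : M.rank = Fintype.card m) (μ : Measure ℝ) [SigmaFinite μ]
    [NullSingletonClass μ] :
    (Measure.pi fun _ : n => Measure.pi fun _ : m => μ)
      {Y : n → m → ℝ | (M * (Matrix.of Y).map (Complex.ofReal : ℝ → ℂ)).det = 0} = 0 := by
  obtain ⟨B, hB⟩ := M.exists_mul_eq_one_of_rank_eq_card hM
  have hp : M.detMulGeneric ≠ 0 := fun h => by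
    have hx := M.eval_detMulGeneric fun ij => B ij.1 ij.2
    have hB' : M * Matrix.of (fun i j => B i j) = 1 := hB
    simp [h, hB'] at hx
  rw [← MvPolynomial.measure_pi_setOf_eval_ofReal_eq_zero μ hp,
    ← (measurePreserving_curry_symm_pi μ).measure_preimage_equiv]
  congr 1
  ext Y
  rw [Set.mem_preimage, Set.mem_ofPred_eq, Set.mem_ofPred_eq, Matrix.eval_detMulGeneric]
  rfl

/-- Lemma 3.1: if `M` is an `s × n` complex matrix of rank `s`, then the set of
real `n × s` matrices `Y` (regarded entrywise as complex) with `M Y` singular has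
Lebesgue measure zero; consequently, if the entries of `Y` are i.i.d. with a
distribution absolutely continuous w.r.t. Lebesgue measure, then `M Y` is
nonsingular with probability 1. -/
theorem random_matrix_nonsingular (n s : ℕ) (hs : s ≤ n)
    (M : Matrix (Fin s) (Fin n) ℂ) (hM : M.rank = s) :
    volume {Y : Fin n → Fin s → ℝ |
        (M * (Matrix.of Y).map (Complex.ofReal : ℝ → ℂ)).det = 0} = 0 ∧
    ∀ ν : Measure ℝ, IsProbabilityMeasure ν → ν ≪ volume →
      (Measure.pi fun _ : Fin n => Measure.pi fun _ : Fin s => ν)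
        {Y : Fin n → Fin s → ℝ |
          (M * (Matrix.of Y).map (Complex.ofReal : ℝ → ℂ)).det ≠ 0} = 1 := by
  refine ⟨M.measure_pi_setOf_det_mul_ofReal_eq_zero (by simpa using hM) volume,
    fun ν _ hν => ?_⟩
  have : NullSingletonClass ν := ⟨fun x => hν (measure_singleton x)⟩
  have hae := M.measure_pi_setOf_det_mul_ofReal_eq_zero (by simpa using hM) ν
  refine (prob_compl_eq_zero_iff₀ ?_).mp ?_
  · exact (NullMeasurableSet.of_null hae).compl
  · simpa [Set.compl_ofPred] using hae
end

section
/- Let A, B ∈ ℂ^{n×n} and U ∈ ℂ^{n×t} be such that B·U has rank t, and suppose there exists G ∈ ℂ^{t×t} with A·U = B·U·G (i.e. the columns of A·U lie in the column space of B·U). Define Ã := (B·U)*·A·U and B̃ := (B·U)*·B·U. If y ∈ ℂ^t is nonzero and λ ∈ ℂ satisfy Ã·y = λ·B̃·y, then U·y ≠ 0 and A·(U·y) = λ·B·(U·y); that is, every eigenpair of the projected pencil (Ã, B̃) lifts to an eigenpair of the pencil (A, B) with eigenvector U·y. -/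
open Matrix

/-- A matrix over a field whose rank equals its number of columns has injective `mulVec`. -/
theorem Matrix.mulVec_injective_of_rank_eq_card {m n K : Type*} [Fintype n] [Field K]
    {W : Matrix m n K} (h : W.rank = Fintype.card n) : Function.Injective W.mulVec := by
  have hker := W.mulVecLin.finrank_range_add_finrank_ker
  rw [← Matrix.rank, h, Module.finrank_fintype_fun_eq_card] at hker
  have hzero : Module.finrank K (LinearMap.ker W.mulVecLin) = 0 := by omega
  exact LinearMap.ker_eq_bot.mp (Submodule.finrank_eq_zero.mp hzero)

/-- First half of Theorem 3.2(a): eigenpair extraction by the oblique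
Petrov–Galerkin projection. If `B U` has full column rank `t` and
`A U = B U G` for some `G`, then every eigenpair `(λ, y)` of the projected pencil
`(Ã, B̃) = ((BU)ᴴ A U, (BU)ᴴ B U)` lifts to the eigenpair `(λ, U y)` of `(A, B)`. -/
theorem oblique_projection_eigenpair_lift (n t : ℕ)
    (A B : Matrix (Fin n) (Fin n) ℂ) (U : Matrix (Fin n) (Fin t) ℂ)
    (hrank : (B * U).rank = t)
    (G : Matrix (Fin t) (Fin t) ℂ) (hG : A * U = B * U * G)
    (Atil Btil : Matrix (Fin t) (Fin t) ℂ)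
    (hAtil : Atil = (B * U)ᴴ * A * U) (hBtil : Btil = (B * U)ᴴ * B * U)
    (y : Fin t → ℂ) (hy : y ≠ 0) (lam : ℂ)
    (heig : Atil *ᵥ y = lam • (Btil *ᵥ y)) :
    U *ᵥ y ≠ 0 ∧ A *ᵥ (U *ᵥ y) = lam • (B *ᵥ (U *ᵥ y)) := by
  have hinj : Function.Injective (B * U).mulVec :=
    Matrix.mulVec_injective_of_rank_eq_card (by simpa using hrank)
  refine ⟨fun hUy => hy (hinj ?_), ?_⟩
  · rw [← mulVec_mulVec, hUy, mulVec_zero, mulVec_zero]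
  · subst hAtil hBtil
    open scoped ComplexOrder in
    rw [Matrix.mul_assoc, Matrix.mul_assoc, hG, ← sub_eq_zero, ← Matrix.mul_assoc,
      ← mulVec_mulVec, ← mulVec_smul, ← mulVec_sub,
      conjTranspose_mul_self_mulVec_eq_zero, mulVec_sub, mulVec_smul, sub_eq_zero,
      mulVec_mulVec, ← hG] at heig
    rwa [mulVec_mulVec, mulVec_mulVec]
end

section
/- Suppose the pencil zB−A is in Weierstrass form with data (S,T,d,J,N), that J splits at s with J = [[J₁,0],[0,J₂]], and let Y ∈ ℂ^{n×s}. Set S₁ := the n×s matrix of the first s columns of S, W := (S^{-1})₁·Y where (S^{-1})₁ is the s×n matrix of the first s rows of S^{-1}, U := S₁·W, Ã := (B·U)*·A·U and B̃ := (B·U)*·B·U. Then for every z ∈ ℂ one has the s×s matrix identity z·B̃ − Ã = (B·U)*·(B·S₁)·(z·I_s − J₁)·W. -/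
open Matrix

/-- Equation (4-2-18): with `W = (S⁻¹)₁ Y`, `U = S₁ W`, `Ã = (BU)ᴴ A U` and
`B̃ = (BU)ᴴ B U`, one has `z B̃ - Ã = (BU)ᴴ (B S₁) (z I_s - J₁) W` for all `z`.
Dimensions: `n = (s + r) + e`, `d = s + r`. -/
theorem projected_pencil_identity (s r e : ℕ)
    (A B S T : Matrix ((Fin s ⊕ Fin r) ⊕ Fin e) ((Fin s ⊕ Fin r) ⊕ Fin e) ℂ)
    (J : Matrix (Fin s ⊕ Fin r) (Fin s ⊕ Fin r) ℂ)
    (J₁ : Matrix (Fin s) (Fin s) ℂ) (J₂ : Matrix (Fin r) (Fin r) ℂ)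
    (N : Matrix (Fin e) (Fin e) ℂ)
    (hS : IsUnit S) (hT : IsUnit T) (hN : IsNilpotent N)
    (hA : T * A * S = Matrix.fromBlocks J 0 0 (1 : Matrix (Fin e) (Fin e) ℂ))
    (hB : T * B * S = Matrix.fromBlocks (1 : Matrix (Fin s ⊕ Fin r) (Fin s ⊕ Fin r) ℂ) 0 0 N)
    (hJ : J = Matrix.fromBlocks J₁ 0 0 J₂)
    (Y : Matrix ((Fin s ⊕ Fin r) ⊕ Fin e) (Fin s) ℂ)
    (W : Matrix (Fin s) (Fin s) ℂ)
    (hW : W = (S⁻¹).submatrix (fun i : Fin s => Sum.inl (Sum.inl i)) id * Y)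
    (S₁ : Matrix ((Fin s ⊕ Fin r) ⊕ Fin e) (Fin s) ℂ)
    (hS₁ : S₁ = S.submatrix id (fun j : Fin s => Sum.inl (Sum.inl j)))
    (U : Matrix ((Fin s ⊕ Fin r) ⊕ Fin e) (Fin s) ℂ) (hU : U = S₁ * W)
    (Atil Btil : Matrix (Fin s) (Fin s) ℂ)
    (hAtil : Atil = (B * U)ᴴ * A * U) (hBtil : Btil = (B * U)ᴴ * B * U) :
    ∀ z : ℂ,
      z • Btil - Atil =
        (B * U)ᴴ * (B * S₁) * (z • (1 : Matrix (Fin s) (Fin s) ℂ) - J₁) * W := by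
  have key : A * S₁ = B * S₁ * J₁ := by
    have cols (M : Matrix ((Fin s ⊕ Fin r) ⊕ Fin e) ((Fin s ⊕ Fin r) ⊕ Fin e) ℂ) :
        T * (M * S₁) = (T * M * S).submatrix id (fun j : Fin s => Sum.inl (Sum.inl j)) := by
      rw [hS₁, ← Matrix.mul_assoc]
      rfl
    have hTkey : T * (A * S₁) = T * (B * S₁ * J₁) := by
      rw [← Matrix.mul_assoc T (B * S₁), cols A, cols B, hA, hB, hJ]
      ext i j
      rcases i with (i | i) | i <;> simp [Matrix.mul_apply, Matrix.one_apply]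
    have hdet : IsUnit T.det := (Matrix.isUnit_iff_isUnit_det T).mp hT
    simpa only [Matrix.nonsing_inv_mul_cancel_left _ _ hdet] using congrArg (T⁻¹ * ·) hTkey
  intro z
  have hAU : A * U = B * S₁ * (J₁ * W) := by
    rw [hU, ← Matrix.mul_assoc, key, Matrix.mul_assoc]
  have hBU : B * U = B * S₁ * W := by
    rw [hU, ← Matrix.mul_assoc]
  rw [hAtil, hBtil, Matrix.mul_assoc _ A, Matrix.mul_assoc _ B, hAU]
  generalize (B * U)ᴴ = C
  rw [hBU]
  simp only [Matrix.mul_assoc, Matrix.sub_mul, Matrix.mul_sub, Matrix.smul_mul, Matrix.mul_smul,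
    Matrix.one_mul]
end

section
/- Suppose the pencil zB−A is in Weierstrass form with data (S,T,d,J,N), that J splits at s with J = [[J₁,0],[0,J₂]], and let Y ∈ ℂ^{n×s} be such that W := (S^{-1})₁·Y is invertible. Set S₁ := the n×s matrix of the first s columns of S, U := S₁·W, Ã := (B·U)*·A·U and B̃ := (B·U)*·B·U. Then for every z ∈ ℂ: det(z·B̃ − Ã) = 0 if and only if det(z·I_s − J₁) = 0; that is, the eigenvalues of the projected s×s pencil (Ã, B̃) are exactly the eigenvalues of J₁. -/
open Matrix

open scoped ComplexOrder in
/-- The Gram matrix of a complex matrix with a left inverse is nonsingular. -/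
theorem det_conjTranspose_mul_self_ne_zero_of_leftInverse {m k : Type*} [Fintype m] [Fintype k]
    [DecidableEq k] {M : Matrix m k ℂ} {L : Matrix k m ℂ} (hL : L * M = 1) :
    (Mᴴ * M).det ≠ 0 := by
  have hinj : Function.Injective M.mulVec := fun x y hxy => by
    simpa [hL] using congrArg L.mulVec hxy
  exact (PosDef.conjTranspose_mul_self M hinj).det_pos.ne'

/-- If `A V = B V J` and `B V` has a left inverse, then projecting the pencil `z B - A` on the
columns of `V W` with `W` invertible gives a pencil with the eigenvalues of `J`. -/
theorem det_projected_pencil_eq_zero_iff {m k : Type*} [Fintype m] [Fintype k] [DecidableEq k]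
    {A B : Matrix m m ℂ} {V : Matrix m k ℂ} {J W : Matrix k k ℂ} {L : Matrix k m ℂ}
    (hAV : A * V = B * V * J) (hL : L * (B * V) = 1) (hW : IsUnit W) (z : ℂ) :
    (z • ((B * (V * W))ᴴ * B * (V * W)) - (B * (V * W))ᴴ * A * (V * W)).det = 0 ↔
      (z • (1 : Matrix k k ℂ) - J).det = 0 := by
  have hW0 : W.det ≠ 0 := ((isUnit_iff_isUnit_det W).1 hW).ne_zero
  have hfac : z • ((B * (V * W))ᴴ * B * (V * W)) - (B * (V * W))ᴴ * A * (V * W) =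
      Wᴴ * ((B * V)ᴴ * (B * V)) * (z • (1 : Matrix k k ℂ) - J) * W := by
    have hAVW : A * (V * W) = B * V * J * W := by rw [← Matrix.mul_assoc, hAV]
    have hBVW : (B * (V * W))ᴴ = Wᴴ * (B * V)ᴴ := by
      rw [← Matrix.mul_assoc, conjTranspose_mul]
    rw [Matrix.mul_assoc _ A, hAVW, hBVW]
    simp only [Matrix.mul_sub, Matrix.sub_mul, Matrix.mul_smul, Matrix.smul_mul, Matrix.mul_one,
      Matrix.mul_assoc]
  rw [hfac]
  simp only [det_mul (_ * _) W, det_mul _ (z • (1 : Matrix k k ℂ) - J), det_mul Wᴴ,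
    det_conjTranspose, mul_eq_zero, star_eq_zero, hW0,
    det_conjTranspose_mul_self_ne_zero_of_leftInverse hL, false_or, or_false]

/-- Second half of Theorem 3.2(a): the eigenvalues of the projected pencil
`(Ã, B̃)` are exactly the eigenvalues of `J₁`:
`det(z B̃ - Ã) = 0 ↔ det(z I_s - J₁) = 0`.
Dimensions: `n = (s + r) + e`, `d = s + r`. -/
theorem projected_pencil_eigenvalues (s r e : ℕ)
    (A B S T : Matrix ((Fin s ⊕ Fin r) ⊕ Fin e) ((Fin s ⊕ Fin r) ⊕ Fin e) ℂ)
    (J : Matrix (Fin s ⊕ Fin r) (Fin s ⊕ Fin r) ℂ)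
    (J₁ : Matrix (Fin s) (Fin s) ℂ) (J₂ : Matrix (Fin r) (Fin r) ℂ)
    (N : Matrix (Fin e) (Fin e) ℂ)
    (hS : IsUnit S) (hT : IsUnit T) (hN : IsNilpotent N)
    (hA : T * A * S = Matrix.fromBlocks J 0 0 (1 : Matrix (Fin e) (Fin e) ℂ))
    (hB : T * B * S = Matrix.fromBlocks (1 : Matrix (Fin s ⊕ Fin r) (Fin s ⊕ Fin r) ℂ) 0 0 N)
    (hJ : J = Matrix.fromBlocks J₁ 0 0 J₂)
    (Y : Matrix ((Fin s ⊕ Fin r) ⊕ Fin e) (Fin s) ℂ)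
    (W : Matrix (Fin s) (Fin s) ℂ)
    (hW : W = (S⁻¹).submatrix (fun i : Fin s => Sum.inl (Sum.inl i)) id * Y)
    (hWu : IsUnit W)
    (S₁ : Matrix ((Fin s ⊕ Fin r) ⊕ Fin e) (Fin s) ℂ)
    (hS₁ : S₁ = S.submatrix id (fun j : Fin s => Sum.inl (Sum.inl j)))
    (U : Matrix ((Fin s ⊕ Fin r) ⊕ Fin e) (Fin s) ℂ) (hU : U = S₁ * W)
    (Atil Btil : Matrix (Fin s) (Fin s) ℂ)
    (hAtil : Atil = (B * U)ᴴ * A * U) (hBtil : Btil = (B * U)ᴴ * B * U) :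
    ∀ z : ℂ,
      (z • Btil - Atil).det = 0 ↔
        (z • (1 : Matrix (Fin s) (Fin s) ℂ) - J₁).det = 0 := by
  subst hAtil hBtil hU hJ
  let f : Fin s → (Fin s ⊕ Fin r) ⊕ Fin e := fun j => Sum.inl (Sum.inl j)
  let E : Matrix ((Fin s ⊕ Fin r) ⊕ Fin e) (Fin s) ℂ := (1 : Matrix _ _ ℂ).submatrix id f
  have hTB : T * (B * S₁) = E := by
    have h : T * (B * S₁) = (T * B * S).submatrix id f := by
      rw [hS₁, ← Matrix.mul_assoc]; rfl
    rw [h, hB]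
    ext ((i | i) | i) j <;> simp [E, f, one_apply]
  have hTA : T * (A * S₁) = E * J₁ := by
    have h : T * (A * S₁) = (T * A * S).submatrix id f := by
      rw [hS₁, ← Matrix.mul_assoc]; rfl
    rw [h, hA]
    ext ((i | i) | i) j <;> simp [E, f, mul_apply, one_apply]
  have hAS : A * S₁ = B * S₁ * J₁ := by
    have hdet : IsUnit T.det := (isUnit_iff_isUnit_det T).1 hT
    rw [← nonsing_inv_mul_cancel_left T (A * S₁) hdet, hTA, ← hTB, Matrix.mul_assoc T,
      nonsing_inv_mul_cancel_left T _ hdet]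
  have hL : (T.submatrix f id) * (B * S₁) = 1 := by
    have h : (T.submatrix f id) * (B * S₁) = (T * (B * S₁)).submatrix f id := rfl
    rw [h, hTB]
    ext i j
    simp [E, f, one_apply]
  exact det_projected_pencil_eq_zero_iff hAS hL hWu
end

section
/- Suppose the pencil zB−A is in Weierstrass form with data (S,T,d,J,N), that J splits at s with J = [[J₁,0],[0,J₂]], and let Y ∈ ℂ^{n×s} be such that W := (S^{-1})₁·Y is invertible. Set S₁ := the n×s matrix of the first s columns of S, U := S₁·W, Ã := (B·U)*·A·U and B̃ := (B·U)*·B·U. Let λ ∈ ℂ be such that λ·I_{d−s} − J₂ is invertible (λ is not an eigenvalue of J₂). Then the linear map y ↦ U·y restricts to a bijection from the eigenspace 𝒴_λ := {y ∈ ℂ^s : Ã·y = λ·B̃·y} of the projected pencil onto the eigenspace 𝒳_λ := {x ∈ ℂ^n : A·x = λ·B·x} of the original pencil; in particular dim 𝒴_λ = dim 𝒳_λ and U·𝒴_λ = 𝒳_λ. -/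
open Matrix

/-- Multiplying by the first block of columns is multiplying a zero-padded vector. -/
theorem submatrix_inl_inl_mulVec {R k l m n : Type*} [NonUnitalNonAssocSemiring R]
    [Fintype k] [Fintype l] [Fintype m] (S : Matrix n ((k ⊕ l) ⊕ m) R) (v : k → R) :
    S.submatrix id (fun j => Sum.inl (Sum.inl j)) *ᵥ v =
      S *ᵥ Sum.elim (Sum.elim v 0) 0 := by
  ext i
  simp [mulVec, dotProduct]

/-- An invertible matrix acts injectively on vectors. -/
theorem eq_zero_of_isUnit_of_mulVec_eq_zero {R n : Type*} [CommRing R] [Fintype n]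
    [DecidableEq n] {M : Matrix n n R} (hM : IsUnit M) {v : n → R} (h : M *ᵥ v = 0) : v = 0 :=
  mulVec_injective_of_isUnit hM (by simpa using h)

/-- Applying the inverse of an invertible matrix and then the matrix is the identity. -/
theorem mulVec_inv_mulVec {R n : Type*} [CommRing R] [Fintype n] [DecidableEq n]
    {M : Matrix n n R} (hM : IsUnit M) (v : n → R) : M *ᵥ M⁻¹ *ᵥ v = v := by
  rw [mulVec_mulVec, mul_nonsing_inv _ ((isUnit_iff_isUnit_det M).1 hM), one_mulVec]

/-- Theorem 3.2(b): if `λ` is not an eigenvalue of `J₂`, then `y ↦ U y` restricts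
to a bijection from the eigenspace `𝒴_λ = ker(Ã - λ B̃)` of the projected pencil
onto the eigenspace `𝒳_λ = ker(A - λ B)` of the original pencil; in particular
`U 𝒴_λ = 𝒳_λ` and `dim 𝒴_λ = dim 𝒳_λ`.
Dimensions: `n = (s + r) + e`, `d = s + r`. -/
theorem projected_pencil_eigenspaces (s r e : ℕ)
    (A B S T : Matrix ((Fin s ⊕ Fin r) ⊕ Fin e) ((Fin s ⊕ Fin r) ⊕ Fin e) ℂ)
    (J : Matrix (Fin s ⊕ Fin r) (Fin s ⊕ Fin r) ℂ)
    (J₁ : Matrix (Fin s) (Fin s) ℂ) (J₂ : Matrix (Fin r) (Fin r) ℂ)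
    (N : Matrix (Fin e) (Fin e) ℂ)
    (hS : IsUnit S) (hT : IsUnit T) (hN : IsNilpotent N)
    (hA : T * A * S = Matrix.fromBlocks J 0 0 (1 : Matrix (Fin e) (Fin e) ℂ))
    (hB : T * B * S = Matrix.fromBlocks (1 : Matrix (Fin s ⊕ Fin r) (Fin s ⊕ Fin r) ℂ) 0 0 N)
    (hJ : J = Matrix.fromBlocks J₁ 0 0 J₂)
    (Y : Matrix ((Fin s ⊕ Fin r) ⊕ Fin e) (Fin s) ℂ)
    (W : Matrix (Fin s) (Fin s) ℂ)
    (hW : W = (S⁻¹).submatrix (fun i : Fin s => Sum.inl (Sum.inl i)) id * Y)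
    (hWu : IsUnit W)
    (S₁ : Matrix ((Fin s ⊕ Fin r) ⊕ Fin e) (Fin s) ℂ)
    (hS₁ : S₁ = S.submatrix id (fun j : Fin s => Sum.inl (Sum.inl j)))
    (U : Matrix ((Fin s ⊕ Fin r) ⊕ Fin e) (Fin s) ℂ) (hU : U = S₁ * W)
    (Atil Btil : Matrix (Fin s) (Fin s) ℂ)
    (hAtil : Atil = (B * U)ᴴ * A * U) (hBtil : Btil = (B * U)ᴴ * B * U)
    (lam : ℂ) (hlam : IsUnit (lam • (1 : Matrix (Fin r) (Fin r) ℂ) - J₂)) :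
    Submodule.map U.mulVecLin (LinearMap.ker (Atil - lam • Btil).mulVecLin) =
        LinearMap.ker (A - lam • B).mulVecLin ∧
    (∀ y ∈ LinearMap.ker (Atil - lam • Btil).mulVecLin,
        U.mulVecLin y = 0 → y = 0) ∧
    Module.finrank ℂ (LinearMap.ker (Atil - lam • Btil).mulVecLin) =
      Module.finrank ℂ (LinearMap.ker (A - lam • B).mulVecLin) := by
  subst hU hS₁ hAtil hBtil hJ
  set S₁ := S.submatrix id (fun j : Fin s => Sum.inl (Sum.inl j)) with hS₁
  have hBS (v : Fin s → ℂ) : T *ᵥ (B * S₁) *ᵥ v = Sum.elim (Sum.elim v 0) 0 := by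
    rw [← mulVec_mulVec, hS₁, submatrix_inl_inl_mulVec, mulVec_mulVec, mulVec_mulVec,
      hB, fromBlocks_mulVec]
    simp
  have hAS (v : Fin s → ℂ) : A *ᵥ S₁ *ᵥ v = B *ᵥ S₁ *ᵥ J₁ *ᵥ v := by
    apply mulVec_injective_of_isUnit hT
    rw [mulVec_mulVec _ B, hBS, hS₁, submatrix_inl_inl_mulVec, mulVec_mulVec, mulVec_mulVec,
      hA, fromBlocks_mulVec]
    simp [fromBlocks_mulVec]
  have hinj (y : Fin s → ℂ) (hy : (S₁ * W) *ᵥ y = 0) : y = 0 := by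
    apply eq_zero_of_isUnit_of_mulVec_eq_zero hWu
    have h := hBS (W *ᵥ y)
    rw [← mulVec_mulVec, mulVec_mulVec _ S₁, hy, mulVec_zero, mulVec_zero] at h
    ext i
    simpa using (congrFun h (Sum.inl (Sum.inl i))).symm
  have hres (y : Fin s → ℂ) : (A - lam • B) *ᵥ (S₁ * W) *ᵥ y =
      (B * (S₁ * W)) *ᵥ W⁻¹ *ᵥ (J₁ *ᵥ W *ᵥ y - lam • W *ᵥ y) := by
    simp only [← mulVec_mulVec, mulVec_inv_mulVec hWu, sub_mulVec, smul_mulVec, hAS, mulVec_sub,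
      mulVec_smul]
  have hproj (y : Fin s → ℂ) :
      ((B * (S₁ * W))ᴴ * A * (S₁ * W) - lam • ((B * (S₁ * W))ᴴ * B * (S₁ * W))) *ᵥ y =
        (B * (S₁ * W))ᴴ *ᵥ (A - lam • B) *ᵥ (S₁ * W) *ᵥ y := by
    simp only [mulVec_mulVec, Matrix.sub_mul, Matrix.mul_sub, Matrix.smul_mul, Matrix.mul_smul,
      Matrix.mul_assoc]
  have hker (y : Fin s → ℂ) :
      ((B * (S₁ * W))ᴴ * A * (S₁ * W) - lam • ((B * (S₁ * W))ᴴ * B * (S₁ * W))) *ᵥ y = 0 ↔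
        (A - lam • B) *ᵥ (S₁ * W) *ᵥ y = 0 := by
    rw [hproj, hres, mulVec_mulVec _ (B * (S₁ * W))ᴴ]
    open scoped ComplexOrder in rw [conjTranspose_mul_self_mulVec_eq_zero]
  have hsurj (x : (Fin s ⊕ Fin r) ⊕ Fin e → ℂ) (hx : (A - lam • B) *ᵥ x = 0) :
      ∃ y, (S₁ * W) *ᵥ y = x := by
    obtain ⟨z, rfl⟩ : ∃ z, S *ᵥ z = x := ⟨_, mulVec_inv_mulVec hS x⟩
    obtain ⟨u, v, w, rfl⟩ : ∃ (u : Fin s → ℂ) (v : Fin r → ℂ) (w : Fin e → ℂ),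
        z = Sum.elim (Sum.elim u v) w :=
      ⟨_, _, z ∘ Sum.inr, by rw [Sum.elim_comp_inl_inr (z ∘ Sum.inl), Sum.elim_comp_inl_inr]⟩
    have h : (T * A * S - lam • (T * B * S)) *ᵥ Sum.elim (Sum.elim u v) w = 0 := by
      rw [← mulVec_zero T, ← hx]
      simp only [mulVec_mulVec, Matrix.sub_mul, Matrix.mul_sub, Matrix.smul_mul, Matrix.mul_smul,
        Matrix.mul_assoc]
    simp only [hA, hB, sub_mulVec, smul_mulVec, fromBlocks_mulVec] at h
    have hv : v = 0 := by
      apply eq_zero_of_isUnit_of_mulVec_eq_zero hlam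
      ext i
      have hi := congrFun h (Sum.inl (Sum.inr i))
      simp [sub_mulVec, smul_mulVec] at hi ⊢
      linear_combination -hi
    have hw : w = 0 := by
      have hNu : IsUnit (1 - lam • N) := (hN.smul lam).isUnit_one_sub
      apply eq_zero_of_isUnit_of_mulVec_eq_zero hNu
      ext i
      simpa [sub_mulVec, smul_mulVec] using congrFun h (Sum.inr i)
    refine ⟨W⁻¹ *ᵥ u, ?_⟩
    rw [← mulVec_mulVec, mulVec_inv_mulVec hWu, hS₁, submatrix_inl_inl_mulVec, hv, hw]
  have hmap : Submodule.map (S₁ * W).mulVecLin (LinearMap.ker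
      ((B * (S₁ * W))ᴴ * A * (S₁ * W) - lam • ((B * (S₁ * W))ᴴ * B * (S₁ * W))).mulVecLin) =
        LinearMap.ker (A - lam • B).mulVecLin := by
    ext x
    simp only [Submodule.mem_map, LinearMap.mem_ker, mulVecLin_apply, hker]
    constructor
    · rintro ⟨y, hy, rfl⟩
      exact hy
    · intro hx
      obtain ⟨y, rfl⟩ := hsurj x hx
      exact ⟨y, hx, rfl⟩
  refine ⟨hmap, fun y _ => hinj y, ?_⟩
  rw [← hmap]
  exact (Submodule.equivMapOfInjective _ ((injective_iff_map_eq_zero _).2 hinj) _).finrank_eq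
end
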